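/- arXiv:quant-ph/0511147 — 2 statements merged into one kernel-verified Lean document; each statement's English description precedes it below -/
import Mathlib

section
/- Let G be a finite simple cograph on n vertices, i.e., a graph with no induced subgraph isomorphic to the path P₄ on four vertices. If the rows of the adjacency matrix of G are pairwise distinct and none is the zero row (equivalently, no vertex is isolated and no two distinct vertices have exactly the same neighborhood), then the adjacency matrix of G over ℝ is invertible, i.e., r(G) = n. -/
attribute [local instance] Classical.propDecidable

/-- No four vertices `a, b, c, d` induce a path `a - b - c - d`. The vertices are not assumed
distinct, since the adjacency conditions force them to be. -/
def SimpleGraph.P4Free {V : Type*} (G : SimpleGraph V) : Prop :=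
  ∀ a b c d : V, G.Adj a b → G.Adj b c → G.Adj c d →
    ¬ G.Adj a c → ¬ G.Adj b d → G.Adj a d

theorem SimpleGraph.P4Free.compl {V : Type*} {G : SimpleGraph V} (h : G.P4Free) :
    Gᶜ.P4Free := by
  intro a b c d hab hbc hcd hac hbd
  have := h c a d b
  simp only [SimpleGraph.compl_adj] at *
  grind [SimpleGraph.adj_comm]

theorem SimpleGraph.p4Free_of_induce {V : Type*} {G : SimpleGraph V}
    (h : ∀ s : Set V, ¬ Nonempty (G.induce s ≃g SimpleGraph.pathGraph 4)) : G.P4Free := by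
  intro a b c d hab hbc hcd hac hbd
  by_contra had
  have hadj : ∀ i j : Fin 4, G.Adj (![a, b, c, d] i) (![a, b, c, d] j) ↔
      (SimpleGraph.pathGraph 4).Adj i j := by
    intro i j
    fin_cases i <;> fin_cases j <;>
      simp [SimpleGraph.pathGraph_adj, hab, hbc, hcd, hac, hbd, had, hab.symm, hbc.symm,
        hcd.symm, G.adj_comm c a, G.adj_comm d b, G.adj_comm d a]
  have hinj : Function.Injective ![a, b, c, d] := by
    have h1 := hab.ne
    have h2 := hbc.ne
    have h3 := hcd.ne
    have h4 : a ≠ c := by rintro rfl; exact had hcd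
    have h5 : b ≠ d := by rintro rfl; exact had hab
    have h6 : a ≠ d := by rintro rfl; exact hbd hab.symm
    intro i j hij
    fin_cases i <;> fin_cases j <;> simp_all
  refine h (Set.range ![a, b, c, d]) ⟨SimpleGraph.Iso.symm ⟨Equiv.ofInjective _ hinj, ?_⟩⟩
  intro i j
  exact hadj i j

/-- If `S` has a bipartition without crossing edges, then `insert v S` has a bipartition either
without crossing edges or with all crossing edges. -/
theorem SimpleGraph.P4Free.exists_split_insert {V : Type*} {G : SimpleGraph V} (hG : G.P4Free)
    {S : Finset V} {v : V} (hv : v ∉ S)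
    (hS : ∃ A ⊂ S, A.Nonempty ∧ ∀ a ∈ A, ∀ b ∈ S \ A, ¬ G.Adj a b) :
    (∃ A ⊂ insert v S, A.Nonempty ∧ ∀ a ∈ A, ∀ b ∈ insert v S \ A, ¬ G.Adj a b) ∨
    ∃ A ⊂ insert v S, A.Nonempty ∧ ∀ a ∈ A, ∀ b ∈ insert v S \ A, G.Adj a b := by
  by_cases hall : ∀ b ∈ S, G.Adj b v
  · obtain ⟨A, hAS, hA, -⟩ := hS
    right
    refine ⟨S, Finset.ssubset_insert hv, hA.mono hAS.subset, fun a ha b hb => ?_⟩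
    grind
  push Not at hall
  obtain ⟨b, hbS, hbv⟩ := hall
  left
  have hex : ∃ A ⊂ S, b ∈ A ∧ ∀ x ∈ A, ∀ y ∈ S \ A, ¬ G.Adj x y := by
    obtain ⟨A, hAS, hA, hno⟩ := hS
    by_cases hbA : b ∈ A
    · exact ⟨A, hAS, hbA, hno⟩
    · refine ⟨S \ A, Finset.sdiff_ssubset hAS.subset hA, by simp [hbS, hbA], ?_⟩
      intro x hx y hy hxy
      exact hno y (by simp only [Finset.mem_sdiff] at hy; tauto) x hx hxy.symm
  obtain ⟨A, ⟨hAS, hbA, hno⟩, hmin⟩ := WellFounded.has_min (measure (Finset.card (α := V))).wf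
    {A : Finset V | A ⊂ S ∧ b ∈ A ∧ ∀ x ∈ A, ∀ y ∈ S \ A, ¬ G.Adj x y} hex
  by_cases hc : ∃ c ∈ S \ A, G.Adj v c
  swap
  · push Not at hc
    refine ⟨S \ A, (Finset.sdiff_subset).trans_ssubset (Finset.ssubset_insert hv),
      Finset.sdiff_nonempty.2 hAS.2, fun x hx y hy hxy => ?_⟩
    grind [SimpleGraph.adj_comm]
  obtain ⟨c, hcS, hvc⟩ := hc
  by_cases hd : ∃ d ∈ A, G.Adj v d
  swap
  · push Not at hd
    refine ⟨A, hAS.trans (Finset.ssubset_insert hv), ⟨b, hbA⟩, fun x hx y hy hxy => ?_⟩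
    grind [SimpleGraph.adj_comm]
  obtain ⟨d, hdA, hvd⟩ := hd
  exfalso
  have hsub : A.filter (fun x => ¬ G.Adj x v) ⊂ A :=
    Finset.filter_ssubset.2 ⟨d, hdA, by simpa using hvd.symm⟩
  refine hmin (A.filter (fun x => ¬ G.Adj x v)) ⟨hsub.trans hAS, by simp [hbA, hbv], ?_⟩
    (Finset.card_lt_card hsub)
  intro x hx y hy hxy
  have hxA : x ∈ A := (Finset.mem_filter.1 hx).1
  have hxv : ¬ G.Adj x v := (Finset.mem_filter.1 hx).2
  have hyA : y ∈ A := by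
    by_contra hyA
    exact hno x hxA y (by grind) hxy
  have hyv : G.Adj y v := by grind
  exact hno x hxA c hcS (hG x y v c hxy hyv hvc hxv (hno y hyA c hcS))

/-- Seinsche's theorem: a `P₄`-free graph on at least two vertices is disconnected or has
disconnected complement. -/
theorem SimpleGraph.P4Free.exists_split {V : Type*} {G : SimpleGraph V} (hG : G.P4Free)
    (S : Finset V) (hS : 2 ≤ S.card) :
    (∃ A ⊂ S, A.Nonempty ∧ ∀ a ∈ A, ∀ b ∈ S \ A, ¬ G.Adj a b) ∨
    ∃ A ⊂ S, A.Nonempty ∧ ∀ a ∈ A, ∀ b ∈ S \ A, G.Adj a b := by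
  induction S using Finset.induction_on with
  | empty => simp at hS
  | insert v S hv ih =>
    rw [Finset.card_insert_of_notMem hv] at hS
    by_cases h2 : 2 ≤ S.card
    · rcases ih h2 with h | ⟨A, hAS, hA, hall⟩
      · exact hG.exists_split_insert hv h
      · have key : ∀ (T A : Finset V), (∀ a ∈ A, ∀ b ∈ T \ A, ¬ Gᶜ.Adj a b) ↔
            ∀ a ∈ A, ∀ b ∈ T \ A, G.Adj a b := by
          intro T A
          refine forall₄_congr fun a ha b hb => ?_
          have : a ≠ b := by rintro rfl; exact (Finset.mem_sdiff.1 hb).2 ha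
          simp [SimpleGraph.compl_adj, this]
        have key' : ∀ (T A : Finset V), (∀ a ∈ A, ∀ b ∈ T \ A, Gᶜ.Adj a b) ↔
            ∀ a ∈ A, ∀ b ∈ T \ A, ¬ G.Adj a b := by
          intro T A
          refine forall₄_congr fun a ha b hb => ?_
          have : a ≠ b := by rintro rfl; exact (Finset.mem_sdiff.1 hb).2 ha
          simp [SimpleGraph.compl_adj, this]
        have := hG.compl.exists_split_insert hv ⟨A, hAS, hA, (key S A).2 hall⟩
        simp only [key, key'] at this
        exact this.symm
    · obtain ⟨w, rfl⟩ := Finset.card_eq_one.1 (show S.card = 1 by omega)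
      by_cases hvw : G.Adj w v
      · exact Or.inr ⟨{w}, Finset.ssubset_insert hv, by simp, by grind⟩
      · exact Or.inl ⟨{w}, Finset.ssubset_insert hv, by simp, by grind⟩

/-- A `P₄`-free graph on at least two vertices has a pair of (adjacent or nonadjacent) twins. -/
theorem SimpleGraph.P4Free.exists_twins {V : Type*} {G : SimpleGraph V} (hG : G.P4Free)
    (S : Finset V) (hS : 2 ≤ S.card) :
    ∃ u ∈ S, ∃ v ∈ S, u ≠ v ∧ ∀ w ∈ S, w ≠ u → w ≠ v → (G.Adj u w ↔ G.Adj v w) := by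
  induction S using Finset.strongInduction with
  | H S ih =>
    have hsplit : ∃ A ⊂ S, A.Nonempty ∧ ∀ a ∈ A, ∀ a' ∈ A, ∀ b ∈ S \ A, ∀ b' ∈ S \ A,
        (G.Adj a b ↔ G.Adj a' b') := by
      rcases hG.exists_split S hS with ⟨A, hAS, hA, h⟩ | ⟨A, hAS, hA, h⟩
      · exact ⟨A, hAS, hA, fun a ha a' ha' b hb b' hb' =>
          iff_of_false (h a ha b hb) (h a' ha' b' hb')⟩
      · exact ⟨A, hAS, hA, fun a ha a' ha' b hb b' hb' =>
          iff_of_true (h a ha b hb) (h a' ha' b' hb')⟩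
    obtain ⟨A, hAS, hA, h⟩ := hsplit
    by_cases hA2 : 2 ≤ A.card
    · obtain ⟨u, hu, v, hv, huv, htw⟩ := ih A hAS hA2
      refine ⟨u, hAS.subset hu, v, hAS.subset hv, huv, fun w hw hwu hwv => ?_⟩
      grind
    by_cases hB2 : 2 ≤ (S \ A).card
    · obtain ⟨u, hu, v, hv, huv, htw⟩ := ih (S \ A) (Finset.sdiff_ssubset hAS.subset hA) hB2
      refine ⟨u, (Finset.mem_sdiff.1 hu).1, v, (Finset.mem_sdiff.1 hv).1, huv,
        fun w hw hwu hwv => ?_⟩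
      by_cases hwA : w ∈ A
      · rw [G.adj_comm u, G.adj_comm v]
        exact h w hwA w hwA u hu v hv
      · exact htw w (Finset.mem_sdiff.2 ⟨hw, hwA⟩) hwu hwv
    · have hcard := Finset.card_sdiff_add_card_eq_card hAS.subset
      obtain ⟨u, v, huv, rfl⟩ := Finset.card_eq_two.1 (show S.card = 2 by omega)
      exact ⟨u, by simp, v, by simp, huv, by grind⟩

/-- Merging the two coordinates of a kernel vector at a pair of twins with loop weights `p`, `q`:
`t` is the loop weight of the merged vertex. The parameter `e` is the edge weight between the
twins. -/
theorem exists_merged_weight {e p q x y : ℝ} (he : e = 0 ∨ e = 1) (hp : 0 ≤ p) (hp1 : p < 1)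
    (hq : 0 ≤ q) (hq1 : q < 1) (hpq : e = 0 → 0 < p + q)
    (hxy : e * y + p * x = e * x + q * y) :
    ∃ t : ℝ, 0 ≤ t ∧ t < 1 ∧ (t = 0 → e = 0 ∧ (p = 0 ∨ q = 0)) ∧
      t * (x + y) = e * y + p * x ∧ (x + y = 0 → x = 0 ∧ y = 0) := by
  rcases he with rfl | rfl
  · have hs := hpq rfl
    refine ⟨p * q / (p + q), by positivity, ?_, ?_, ?_, ?_⟩
    · rw [div_lt_one hs]
      nlinarith
    · intro h
      rcases div_eq_zero_iff.1 h with h | h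
      · exact ⟨rfl, mul_eq_zero.1 h⟩
      · exact absurd h hs.ne'
    · field_simp
      linear_combination -p * hxy
    · intro h
      have : (p + q) * x = 0 := by linear_combination hxy + q * h
      have hx : x = 0 := by simpa [hs.ne'] using this
      exact ⟨hx, by linarith⟩
  · have hs : 0 < 2 - p - q := by linarith
    have hpq1 : p * q < 1 := by nlinarith
    have ht : 0 < (1 - p * q) / (2 - p - q) := div_pos (by linarith) hs
    refine ⟨(1 - p * q) / (2 - p - q), ht.le, ?_, fun h => absurd h ht.ne', ?_, ?_⟩
    · rw [div_lt_one hs]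
      nlinarith [mul_pos (sub_pos.2 hp1) (sub_pos.2 hq1)]
    · field_simp
      linear_combination (p - 1) * hxy
    · intro h
      have : (2 - p - q) * x = 0 := by linear_combination -hxy + (1 - q) * h
      have hx : x = 0 := by simpa [hs.ne'] using this
      exact ⟨hx, by linarith⟩

/-- A cograph with loop weights `d ∈ [0, 1)` has nonsingular weighted adjacency matrix, provided
no loopless vertex is isolated and no two loopless vertices have the same neighborhood. -/
theorem SimpleGraph.P4Free.eq_zero_of_weighted {V : Type*} {G : SimpleGraph V} (hG : G.P4Free)
    (S : Finset V) (d x : V → ℝ) (hd : ∀ i ∈ S, 0 ≤ d i ∧ d i < 1)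
    (hiso : ∀ i ∈ S, d i = 0 → ∃ w ∈ S, G.Adj i w)
    (htwin : ∀ i ∈ S, ∀ j ∈ S, i ≠ j → d i = 0 → d j = 0 → ∃ w ∈ S, ¬ (G.Adj i w ↔ G.Adj j w))
    (hker : ∀ i ∈ S, ∑ j ∈ S, G.adjMatrix ℝ i j * x j + d i * x i = 0) :
    ∀ i ∈ S, x i = 0 := by
  induction hn : S.card generalizing S d x with
  | zero => simp [Finset.card_eq_zero.1 hn]
  | succ n ih =>
  by_cases h2 : 2 ≤ S.card
  swap
  · obtain ⟨w, rfl⟩ := Finset.card_eq_one.1 (show S.card = 1 by omega)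
    have hdw : d w ≠ 0 := fun h => by simpa using hiso w (by simp) h
    simpa [hdw] using hker w
  obtain ⟨u, hu, v, hv, huv, htw⟩ := hG.exists_twins S h2
  obtain ⟨T, huT, hvT, rfl⟩ : ∃ T : Finset V, u ∉ T ∧ v ∉ T ∧ S = insert u (insert v T) :=
    ⟨(S.erase u).erase v, by simp, by simp, by grind⟩
  have huvT : u ∉ insert v T := by simp [huv, huT]
  have htwT : ∀ w ∈ T, (G.Adj u w ↔ G.Adj v w) := fun w hw =>
    htw w (by simp [hw]) (by grind) (by grind)
  have hsum : ∀ i, ∑ j ∈ insert u (insert v T), G.adjMatrix ℝ i j * x j =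
      G.adjMatrix ℝ i u * x u + (G.adjMatrix ℝ i v * x v + ∑ j ∈ T, G.adjMatrix ℝ i j * x j) := by
    intro i
    rw [Finset.sum_insert huvT, Finset.sum_insert hvT]
  simp only [hsum] at hker
  have hkeru := hker u hu
  have hkerv := hker v hv
  have hsumT : ∑ j ∈ T, G.adjMatrix ℝ v j * x j = ∑ j ∈ T, G.adjMatrix ℝ u j * x j :=
    Finset.sum_congr rfl fun j hj => by simp [SimpleGraph.adjMatrix_apply, htwT j hj]
  have hsym : G.adjMatrix ℝ v u = G.adjMatrix ℝ u v := by
    simp [SimpleGraph.adjMatrix_apply, G.adj_comm]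
  have huu : ∀ i, G.adjMatrix ℝ i i = 0 := by simp
  rw [huu] at hkeru hkerv
  rw [hsumT, hsym] at hkerv
  have he0 : G.adjMatrix ℝ u v = 0 ↔ ¬ G.Adj u v := by simp [SimpleGraph.adjMatrix_apply]
  obtain ⟨t, ht0, ht1, htz, htxy, hxy⟩ := exists_merged_weight (e := G.adjMatrix ℝ u v)
    (p := d u) (q := d v) (x := x u) (y := x v)
    (by by_cases h : G.Adj u v <;> simp [SimpleGraph.adjMatrix_apply, h])
    (hd u hu).1 (hd u hu).2 (hd v hv).1 (hd v hv).2
    (by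
      intro he
      rw [he0] at he
      by_contra hneg
      have h1 := (hd u hu).1
      have h2 := (hd v hv).1
      obtain ⟨w, hw, hne⟩ := htwin u hu v hv huv (by linarith) (by linarith)
      grind [SimpleGraph.adj_comm, SimpleGraph.irrefl])
    (by linarith)
  rw [he0] at htz
  have hmain := ih (insert u T) (Function.update d u t) (Function.update x u (x u + x v))
    (by
      intro i hi
      by_cases hiu : i = u
      · subst hiu; simp [ht0, ht1]
      · simpa [hiu] using hd i (by grind))
    (by
      intro i hi hdi
      by_cases hiu : i = u
      · subst hiu
        rw [Function.update_self] at hdi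
        obtain ⟨hnadj, h | h⟩ := htz hdi
        · obtain ⟨w, hw, hiw⟩ := hiso i hu h
          exact ⟨w, by grind, hiw⟩
        · obtain ⟨w, hw, hiw⟩ := hiso v hv h
          refine ⟨w, ?_, ?_⟩ <;> grind [SimpleGraph.adj_comm, SimpleGraph.irrefl]
      · rw [Function.update_of_ne hiu] at hdi
        obtain ⟨w, hw, hiw⟩ := hiso i (by grind) hdi
        by_cases hwv : w = v
        · exact ⟨u, by simp, by grind [SimpleGraph.adj_comm]⟩
        · exact ⟨w, by grind, hiw⟩)
    (by
      have hu' : ∀ j ∈ T, t = 0 → d j = 0 → ∃ w ∈ insert u T, ¬ (G.Adj u w ↔ G.Adj j w) := by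
        intro j hj ht hdj
        obtain ⟨hnadj, h⟩ := htz ht
        by_cases hju : G.Adj j u
        · exact ⟨u, by simp, by simp [hju]⟩
        have hjv : ¬ G.Adj j v := by grind [SimpleGraph.adj_comm]
        rcases h with h | h
        · obtain ⟨w, hw, hne⟩ := htwin u hu j (by simp [hj]) (by grind) h hdj
          exact ⟨w, by grind, hne⟩
        · obtain ⟨w, hw, hne⟩ := htwin v hv j (by simp [hj]) (by grind) h hdj
          have := G.irrefl (v := v)
          have := G.adj_comm u v
          exact ⟨w, by grind, by grind⟩
      intro i hi j hj hij hdi hdj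
      by_cases hiu : i = u
      · subst hiu
        have hjT : j ∈ T := by grind
        rw [Function.update_self] at hdi
        rw [Function.update_of_ne hij.symm] at hdj
        exact hu' j hjT hdi hdj
      by_cases hju : j = u
      · subst hju
        have hiT : i ∈ T := by grind
        rw [Function.update_self] at hdj
        rw [Function.update_of_ne hij] at hdi
        obtain ⟨w, hw, hne⟩ := hu' i hiT hdj hdi
        exact ⟨w, hw, fun h => hne h.symm⟩
      rw [Function.update_of_ne hiu] at hdi
      rw [Function.update_of_ne hju] at hdj
      obtain ⟨w, hw, hne⟩ := htwin i (by grind) j (by grind) hij hdi hdj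
      by_cases hwv : w = v
      · exact ⟨u, by simp, by grind [SimpleGraph.adj_comm]⟩
      · exact ⟨w, by grind, hne⟩)
    (by
      intro i hi
      have hT : ∑ j ∈ T, G.adjMatrix ℝ i j * Function.update x u (x u + x v) j =
          ∑ j ∈ T, G.adjMatrix ℝ i j * x j :=
        Finset.sum_congr rfl fun j hj => by
          rw [Function.update_of_ne (by rintro rfl; exact huT hj)]
      rw [Finset.sum_insert huT, hT, Function.update_self]
      by_cases hiu : i = u
      · subst hiu
        rw [Function.update_self, Function.update_self, huu]
        linarith
      · have hiT : i ∈ T := by grind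
        have hiuv : G.adjMatrix ℝ i v = G.adjMatrix ℝ i u := by
          simp [SimpleGraph.adjMatrix_apply, G.adj_comm i, htwT i hiT]
        rw [Function.update_of_ne hiu, Function.update_of_ne hiu]
        have := hker i (by simp [hiT])
        rw [hiuv] at this
        linarith)
    (by
      rw [Finset.card_insert_of_notMem huvT, Finset.card_insert_of_notMem hvT] at hn
      rw [Finset.card_insert_of_notMem huT]
      omega)
  have huv0 := hxy (by simpa using hmain u (by simp))
  intro i hi
  rcases Finset.mem_insert.1 hi with rfl | hi
  · exact huv0.1
  rcases Finset.mem_insert.1 hi with rfl | hi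
  · exact huv0.2
  have hiu : i ≠ u := fun h => huT (h ▸ hi)
  simpa [hiu] using hmain i (by simp [hi])

/-- A finite cograph (no induced `P₄`) with no isolated vertex and no two distinct vertices
having the same neighborhood has invertible (real) adjacency matrix. -/
theorem cograph_adjMatrix_isUnit {V : Type*} [Fintype V] (G : SimpleGraph V)
    (hcograph : ∀ s : Set V, ¬ Nonempty (G.induce s ≃g SimpleGraph.pathGraph 4))
    (hNoIsolated : ∀ v : V, ∃ w : V, G.Adj v w)
    (hDistinctNbhds : ∀ v w : V, v ≠ w → G.neighborSet v ≠ G.neighborSet w) :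
    IsUnit (G.adjMatrix ℝ) := by
  rw [← Matrix.mulVec_injective_iff_isUnit, ← Matrix.coe_mulVecLin,
    injective_iff_map_eq_zero]
  intro x hx
  ext i
  refine (SimpleGraph.p4Free_of_induce hcograph).eq_zero_of_weighted Finset.univ 0 x
    (by simp) (by simpa using hNoIsolated) ?_ ?_ i (Finset.mem_univ i)
  · intro i _ j _ hij _ _
    by_contra! h
    exact hDistinctNbhds i j hij (Set.ext fun w => h w (Finset.mem_univ w))
  · intro i _
    have := congrFun hx i
    simpa [Matrix.mulVec, dotProduct] using this
end

section
/- Let T be a finite tree with at least one edge and let L(T) be its line graph. Then the nullity of L(T) is at most 1; that is, the rank over ℝ of the adjacency matrix of L(T) is at least |E(T)| − 1 (so L(T) is either nonsingular or has exactly one zero eigenvalue). -/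
attribute [local instance] Classical.propDecidable

open Matrix

theorem Matrix.rank_add_le_rank_add_rank {m n K : Type*} [Fintype m] [Fintype n] [Field K]
    (A B : Matrix m n K) : (A + B).rank ≤ A.rank + B.rank := by
  have h : (A + B).mulVecLin.range ≤ A.mulVecLin.range ⊔ B.mulVecLin.range := by
    rw [mulVecLin_add]
    exact LinearMap.range_add_le _ _
  exact (Submodule.finrank_mono h).trans (Submodule.finrank_add_le_finrank_add_finrank _ _)

namespace SimpleGraph

variable {V : Type*} [Fintype V] (G : SimpleGraph V) (v : V)

/-- The vertex-edge incidence matrix over `ZMod 2` with the row of `v` deleted. -/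
noncomputable def reducedIncMatrix : Matrix {u : V // u ≠ v} G.edgeSet (ZMod 2) :=
  Matrix.of fun u e => if (u : V) ∈ (e : Sym2 V) then 1 else 0

/-- The indicator vector of the edges incident to `v`. -/
noncomputable def incVec (R : Type*) [Zero R] [One R] : G.edgeSet → R :=
  fun e => if v ∈ (e : Sym2 V) then 1 else 0

variable {G}

theorem sum_ite_mem_edge {R : Type*} [NonAssocSemiring R] {a b : V} (hab : a ≠ b) (y : V → R) :
    ∑ u, y u * (if u ∈ s(a, b) then 1 else 0) = y a + y b := by
  have h : ∀ u, y u * (if u ∈ s(a, b) then 1 else 0) =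
      (if u = a then y u else 0) + (if u = b then y u else 0) := by
    intro u
    by_cases h1 : u = a
    · subst h1; simp [hab]
    · simp [h1]
  rw [Finset.sum_congr rfl fun u _ => h u]
  simp [Finset.sum_add_distrib]

theorem sum_subtype_ne_add {R : Type*} [AddCommMonoid R] (f : V → R) :
    f v + ∑ u : {u : V // u ≠ v}, f u = ∑ u, f u := by
  rw [Fintype.sum_eq_add_sum_subtype_ne f v]

theorem Connected.eq_zero_of_vecMul_reducedIncMatrix_eq_zero (hG : G.Connected)
    {y : {u : V // u ≠ v} → ZMod 2} (hy : y ᵥ* G.reducedIncMatrix v = 0) : y = 0 := by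
  let z : V → ZMod 2 := fun u => if h : u ≠ v then y ⟨u, h⟩ else 0
  have hz : ∀ a b, G.Adj a b → z a = z b := by
    intro a b hab
    have h := congrFun hy ⟨s(a, b), hab⟩
    have h2 := sum_subtype_ne_add v (fun u => z u * (if u ∈ s(a, b) then 1 else 0))
    rw [sum_ite_mem_edge hab.ne] at h2
    have h3 : ∑ u : {u : V // u ≠ v}, z u * (if (u : V) ∈ s(a, b) then 1 else 0) = 0 := by
      refine Eq.trans ?_ h
      refine Finset.sum_congr rfl fun u _ => ?_
      simp [z, u.2, reducedIncMatrix]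
    rw [h3] at h2
    simp only [z, ne_eq, not_true_eq_false, dite_false, zero_mul, add_zero] at h2
    exact CharTwo.add_eq_zero.mp h2.symm
  have hw : ∀ a b, G.Walk a b → z a = z b := by
    intro a b p
    induction p with
    | nil => rfl
    | cons h _ ih => exact (hz _ _ h).trans ih
  funext u
  obtain ⟨p⟩ := hG.preconnected u v
  simpa [z, u.2] using hw _ _ p

theorem lineGraph_adjMatrix_add_vecMulVec_incVec :
    (G.lineGraph).adjMatrix (ZMod 2) + vecMulVec (G.incVec v (ZMod 2)) (G.incVec v (ZMod 2)) =
      (G.reducedIncMatrix v)ᵀ * G.reducedIncMatrix v := by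
  ext e f
  have h := sum_subtype_ne_add v
    (fun u => (if u ∈ (e : Sym2 V) then 1 else 0 : ZMod 2) * (if u ∈ (f : Sym2 V) then 1 else 0))
  have key : ∑ u, (if u ∈ (e : Sym2 V) then 1 else 0 : ZMod 2) *
      (if u ∈ (f : Sym2 V) then 1 else 0) = (G.lineGraph).adjMatrix (ZMod 2) e f := by
    obtain ⟨e, he⟩ := e
    obtain ⟨f, hf⟩ := f
    induction f with | _ a b
    rw [sum_ite_mem_edge (G.ne_of_adj hf)]
    simp only [adjMatrix_apply, lineGraph_adj_iff_exists, Sym2.mem_iff, ne_eq, Subtype.mk.injEq]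
    by_cases hef : e = s(a, b)
    · subst hef
      simpa using CharTwo.add_self_eq_zero (1 : ZMod 2)
    · have hn : ¬ (a ∈ e ∧ b ∈ e) := fun h =>
        hef ((Sym2.mem_and_mem_iff (G.ne_of_adj hf)).mp h)
      by_cases ha : a ∈ e <;> by_cases hb : b ∈ e <;>
        simp_all [and_or_left, exists_or]
  rw [key] at h
  rw [Matrix.add_apply, vecMulVec_apply, ← h, Matrix.mul_apply]
  simp only [incVec, transpose_apply, reducedIncMatrix, of_apply]
  rw [add_right_comm, CharTwo.add_self_eq_zero, zero_add]

theorem IsTree.det_lineGraph_adjMatrix_add_vecMulVec_ne_zero (hG : G.IsTree) :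
    ((G.lineGraph).adjMatrix (ZMod 2) +
      vecMulVec (G.incVec v (ZMod 2)) (G.incVec v (ZMod 2))).det ≠ 0 := by
  have hcard : Fintype.card G.edgeSet = Fintype.card {u : V // u ≠ v} := by
    have h := hG.card_edgeFinset
    rw [← Set.toFinset_card, Fintype.card_subtype_compl, Fintype.card_subtype_eq]
    simp only [edgeFinset] at h
    omega
  let σ : {u : V // u ≠ v} ≃ G.edgeSet := Fintype.equivOfCardEq hcard.symm
  have hdet : ((G.reducedIncMatrix v).submatrix id σ).det ≠ 0 := by
    intro h
    obtain ⟨y, hy0, hy⟩ := exists_vecMul_eq_zero_iff.mpr h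
    refine hy0 (hG.1.eq_zero_of_vecMul_reducedIncMatrix_eq_zero v (funext fun e => ?_))
    simpa [vecMul, dotProduct] using congrFun hy (σ.symm e)
  rw [lineGraph_adjMatrix_add_vecMulVec_incVec, ← det_submatrix_equiv_self σ,
    ← submatrix_mul_equiv _ _ _ (Equiv.refl _), det_mul]
  have ht : ((G.reducedIncMatrix v)ᵀ.submatrix σ (Equiv.refl _)).det =
      ((G.reducedIncMatrix v).submatrix id σ).det := by
    rw [← det_transpose]; rfl
  rw [ht]
  exact mul_ne_zero hdet hdet

end SimpleGraph

/-- The line graph of a finite tree with at least one edge has nullity at most 1: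
the rank of its (real) adjacency matrix is at least `|E(T)| - 1`. -/
theorem lineGraph_tree_nullity_le_one {V : Type*} [Fintype V] (T : SimpleGraph V)
    (hT : T.IsTree) (hE : T.edgeSet.Nonempty) :
    Fintype.card T.edgeSet - 1 ≤ ((T.lineGraph).adjMatrix ℝ).rank := by
  obtain ⟨v⟩ := hT.1.nonempty
  let C (R : Type) [CommRing R] : Matrix T.edgeSet T.edgeSet R :=
    (T.lineGraph).adjMatrix R + vecMulVec (T.incVec v R) (T.incVec v R)
  have hC (R : Type) [CommRing R] : (C R).det = ((C ℤ).det : R) := by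
    rw [Int.cast_det]
    congr 1
    ext e f
    simp [C, SimpleGraph.incVec, vecMulVec_apply, SimpleGraph.adjMatrix_apply]
  have h2 : (C (ZMod 2)).det ≠ 0 := hT.det_lineGraph_adjMatrix_add_vecMulVec_ne_zero v
  have hR : (C ℝ).det ≠ 0 := by
    rw [hC] at h2 ⊢
    exact Int.cast_ne_zero.mpr fun h => h2 (by simp [h])
  have hrank : (C ℝ).rank = Fintype.card T.edgeSet :=
    rank_of_isUnit _ ((isUnit_iff_isUnit_det _).mpr hR.isUnit)
  have hadd := rank_add_le_rank_add_rank ((T.lineGraph).adjMatrix ℝ)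
    (vecMulVec (T.incVec v ℝ) (T.incVec v ℝ))
  have hone := rank_vecMulVec_le (T.incVec v ℝ) (T.incVec v ℝ)
  change (C ℝ).rank ≤ _ at hadd
  omega
end
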